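/- arXiv:2208.04380 — 2 statements merged into one kernel-verified Lean document; each statement's English description precedes it below -/
import Mathlib

section
/- Any maximal repeat in a word w that is covered by a maximal overlapped repeat is also covered by the principal repeat of some maximal repetition of w. -/
variable {A : Type*}

/-- `p` is a period of the factor `w[i..j]` of the word `w` (positions are 1-based):
`1 ≤ p ≤ j - i + 1` and `w[k] = w[k+p]` whenever both positions lie in `[i, j]`. -/
def IsPeriodOf (w : ℕ → A) (i j p : ℕ) : Prop :=
  1 ≤ p ∧ p ≤ j - i + 1 ∧ ∀ k, i ≤ k → k + p ≤ j → w k = w (k + p)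

/-- The minimal period of the factor `w[i..j]`. -/
noncomputable def minPer (w : ℕ → A) (i j : ℕ) : ℕ :=
  sInf {p | IsPeriodOf w i j p}

/-- The maximality conditions for a factor `w[i..j]` of the word `w` of length `n`,
with respect to its minimal period: it cannot be extended to the left or to the right
by one letter preserving the minimal period. -/
def MaxCond (n : ℕ) (w : ℕ → A) (i j : ℕ) : Prop :=
  (1 < i → w (i - 1) ≠ w (i + minPer w i j - 1)) ∧
  (j < n → w (j + 1) ≠ w (j - minPer w i j + 1))

/-- `w[i..j]` is a maximal repetition (run) in the word `w` of length `n`. -/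
def IsMaxRepetition (n : ℕ) (w : ℕ → A) (i j : ℕ) : Prop :=
  1 ≤ i ∧ i ≤ j ∧ j ≤ n ∧ 2 * minPer w i j ≤ j - i + 1 ∧ MaxCond n w i j

/-- `w[i..j]` is a maximal subrepetition in the word `w` of length `n`:
its exponent is strictly between 1 and 2 and it satisfies the maximality conditions. -/
def IsMaxSubrepetition (n : ℕ) (w : ℕ → A) (i j : ℕ) : Prop :=
  1 ≤ i ∧ i ≤ j ∧ j ≤ n ∧ minPer w i j < j - i + 1 ∧
    j - i + 1 < 2 * minPer w i j ∧ MaxCond n w i j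

/-- A repeat in the word `w` of length `n`: a pair of equal factors
`w[b1..e1]` (left copy) and `w[b2..e2]` (right copy) with `b1 < b2`. -/
structure WordRepeat (n : ℕ) (w : ℕ → A) where
  b1 : ℕ
  e1 : ℕ
  b2 : ℕ
  e2 : ℕ
  one_le_b1 : 1 ≤ b1
  b1_le_e1 : b1 ≤ e1
  b2_le_e2 : b2 ≤ e2
  e2_le_n : e2 ≤ n
  b1_lt_b2 : b1 < b2
  len_eq : e1 - b1 = e2 - b2
  copies_eq : ∀ k, k ≤ e1 - b1 → w (b1 + k) = w (b2 + k)

namespace WordRepeat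

variable {n : ℕ} {w : ℕ → A}

/-- The period of the repeat. -/
def p (σ : WordRepeat n w) : ℕ := σ.b2 - σ.b1

/-- The length of the copies of the repeat. -/
def c (σ : WordRepeat n w) : ℕ := σ.e1 - σ.b1 + 1

/-- The repeat is maximal: its copies cannot be simultaneously extended to the left
or to the right preserving the period. (`fact σ = w[b1..e2]`.) -/
def Maximal (σ : WordRepeat n w) : Prop :=
  (1 < σ.b1 → w (σ.b1 - 1) ≠ w (σ.b2 - 1)) ∧
  (σ.e2 < n → w (σ.e1 + 1) ≠ w (σ.e2 + 1))

/-- The repeat is overlapped: its copies are overlapped factors. -/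
def Overlapped (σ : WordRepeat n w) : Prop := σ.b2 ≤ σ.e1 + 1

/-- The repeat is gapped: there is a nonempty gap between its copies. -/
def Gapped (σ : WordRepeat n w) : Prop := σ.e1 + 1 < σ.b2

/-- The repeat is `α`-gapped: it is gapped and `p(σ) ≤ α ⬝ c(σ)`. -/
def AlphaGapped (α : ℝ) (σ : WordRepeat n w) : Prop :=
  σ.Gapped ∧ (σ.p : ℝ) ≤ α * (σ.c : ℝ)

/-- `σ` is covered by `σ'`: `fact σ = w[σ.b1..σ.e2]` is contained in
`fact σ' = w[σ'.b1..σ'.e2]` and `p(σ') < p(σ)`. -/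
def CoveredBy (σ σ' : WordRepeat n w) : Prop :=
  σ'.b1 ≤ σ.b1 ∧ σ.e2 ≤ σ'.e2 ∧ σ'.p < σ.p

end WordRepeat

/-- `σ` is the principal repeat of some maximal repetition of `w`
(a reprincipal repeat). -/
def IsPrincipalOfMaxRepetition {n : ℕ} {w : ℕ → A} (σ : WordRepeat n w) : Prop :=
  ∃ i j, IsMaxRepetition n w i j ∧ σ.b1 = i ∧ σ.e1 = j - minPer w i j ∧
    σ.b2 = i + minPer w i j ∧ σ.e2 = j

/-- `σ` is principal: it is the principal repeat of some maximal repetition or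
maximal subrepetition of `w`. -/
def IsPrincipal {n : ℕ} {w : ℕ → A} (σ : WordRepeat n w) : Prop :=
  ∃ i j, (IsMaxRepetition n w i j ∨ IsMaxSubrepetition n w i j) ∧ σ.b1 = i ∧
    σ.e1 = j - minPer w i j ∧ σ.b2 = i + minPer w i j ∧ σ.e2 = j

/-- `σ` is a periodic repeat: its copies are repetitions whose minimal period
is at most `c(σ)/3`. -/
def IsPeriodicRepeat {n : ℕ} {w : ℕ → A} (σ : WordRepeat n w) : Prop :=
  3 * minPer w σ.b1 σ.e1 ≤ σ.c

/-- The periodic repeat `σ` is represented by the maximal repetition `w[i..j]`: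
both copies of `σ` extend (preserving their minimal period) to `w[i..j]`;
equivalently, `w[i..j]` is a maximal repetition whose minimal period equals the
minimal period of the copies of `σ` and which contains both copies of `σ`. -/
def RepresentedBy {n : ℕ} {w : ℕ → A} (σ : WordRepeat n w) (i j : ℕ) : Prop :=
  IsPeriodicRepeat σ ∧ IsMaxRepetition n w i j ∧
  minPer w i j = minPer w σ.b1 σ.e1 ∧ i ≤ σ.b1 ∧ σ.e2 ≤ j

/-- The periodic repeat `σ` is represented by the pair of distinct maximal repetitions
`w[i1..j1]`, `w[i2..j2]`: the left copy of `σ` extends to `w[i1..j1]`, the right copy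
extends to `w[i2..j2]`, the two repetitions being distinct (`σ` is birepresented). -/
def RepresentedByPair {n : ℕ} {w : ℕ → A} (σ : WordRepeat n w)
    (i1 j1 i2 j2 : ℕ) : Prop :=
  IsPeriodicRepeat σ ∧ IsMaxRepetition n w i1 j1 ∧ IsMaxRepetition n w i2 j2 ∧
  minPer w i1 j1 = minPer w σ.b1 σ.e1 ∧ minPer w i2 j2 = minPer w σ.b1 σ.e1 ∧
  i1 ≤ σ.b1 ∧ σ.e1 ≤ j1 ∧ i2 ≤ σ.b2 ∧ σ.e2 ≤ j2 ∧ ¬(i1 = i2 ∧ j1 = j2)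


/-- A period of a factor bounds its minimal period, which is itself a period. -/
theorem IsPeriodOf.minPer_spec {A : Type*} {w : ℕ → A} {i j p : ℕ} (hp : IsPeriodOf w i j p) :
    IsPeriodOf w i j (minPer w i j) ∧ minPer w i j ≤ p :=
  ⟨Nat.sInf_mem (s := {p | IsPeriodOf w i j p}) ⟨p, hp⟩, Nat.sInf_le hp⟩

/-- If `q ≤ p` are periods of `w[i..j]`, whose length is at least `2 * p`, and `w[i..j]` cannot be
extended preserving the period `p`, then it cannot be extended preserving the period `q`. -/
theorem IsPeriodOf.not_extendable_of_le {A : Type*} {n : ℕ} {w : ℕ → A} {i j p q : ℕ}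
    (hp : IsPeriodOf w i j p) (hq : IsPeriodOf w i j q) (hqp : q ≤ p) (hlen : 2 * p ≤ j + 1 - i)
    (hleft : 1 < i → w (i - 1) ≠ w (i + p - 1))
    (hright : j < n → w (j + 1) ≠ w (j - p + 1)) :
    (1 < i → w (i - 1) ≠ w (i + q - 1)) ∧ (j < n → w (j + 1) ≠ w (j - q + 1)) := by
  obtain ⟨hp1, -, hp⟩ := hp
  obtain ⟨hq1, -, hq⟩ := hq
  refine ⟨fun hi h => hleft hi (h.trans ?_), fun hj h => hright hj (h.trans ?_)⟩
  · rw [hp (i + q - 1) (by omega) (by omega), hq (i + p - 1) (by omega) (by omega)]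
    congr 1
    omega
  · have h1 := hp (j + 1 - q - p) (by omega) (by omega)
    have h2 := hq (j + 1 - q - p) (by omega) (by omega)
    rw [show j - q + 1 = j + 1 - q - p + p by omega, show j - p + 1 = j + 1 - q - p + q by omega,
      ← h1, ← h2]

/-- The period of an overlapped repeat is a period of the factor it spans. -/
theorem WordRepeat.Overlapped.isPeriodOf {A : Type*} {n : ℕ} {w : ℕ → A} {σ : WordRepeat n w}
    (h : σ.Overlapped) : IsPeriodOf w σ.b1 σ.e2 σ.p := by
  obtain ⟨b1, e1, b2, e2, h1, h2, h3, h4, h5, h6, h7⟩ := σ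
  simp only [WordRepeat.Overlapped, WordRepeat.p] at *
  refine ⟨by omega, by omega, fun k hk hk' => ?_⟩
  have := h7 (k - b1) (by omega)
  rwa [show b1 + (k - b1) = k by omega, show b2 + (k - b1) = k + (b2 - b1) by omega] at this

/-- Any maximal repeat covered by a maximal overlapped repeat is also covered by the
principal repeat of some maximal repetition. -/
theorem covered_by_principal_of_covered_by_overlapped {A : Type*} (n : ℕ) (w : ℕ → A)
    (σ σ' : WordRepeat n w) (hσ : σ.Maximal) (hσ' : σ'.Maximal)
    (hover : σ'.Overlapped) (hcov : σ.CoveredBy σ') :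
    ∃ τ : WordRepeat n w, τ.Maximal ∧ IsPrincipalOfMaxRepetition τ ∧
      σ.CoveredBy τ := by
  have hper := hover.isPeriodOf
  obtain ⟨hq, hqp⟩ := hper.minPer_spec
  obtain ⟨hb, he, hpp⟩ := hcov
  obtain ⟨hleft, hright⟩ := hσ'
  have hb1 := σ'.one_le_b1
  have hbe1 := σ'.b1_le_e1
  have hbe2 := σ'.b2_le_e2
  have hbb := σ'.b1_lt_b2
  have hl := σ'.len_eq
  have hn := σ'.e2_le_n
  have hpdef : σ'.p = σ'.b2 - σ'.b1 := rfl
  have hover' : σ'.b2 ≤ σ'.e1 + 1 := hover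
  have hmax : MaxCond n w σ'.b1 σ'.e2 := by
    refine hper.not_extendable_of_le hq hqp (by omega) ?_ ?_
    · rwa [show σ'.b1 + σ'.p - 1 = σ'.b2 - 1 by omega]
    · rw [show σ'.e2 - σ'.p + 1 = σ'.e1 + 1 by omega]
      exact fun h => (hright h).symm
  obtain ⟨hq1, -, hqper⟩ := hq
  refine ⟨⟨σ'.b1, σ'.e2 - minPer w σ'.b1 σ'.e2, σ'.b1 + minPer w σ'.b1 σ'.e2, σ'.e2, hb1, by omega,
    by omega, hn, by omega, by omega, fun k hk => ?_⟩, ⟨hmax.1, fun h => (hmax.2 h).symm⟩,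
    ⟨σ'.b1, σ'.e2, ⟨hb1, by omega, hn, by omega, hmax⟩, rfl, rfl, rfl, rfl⟩, hb, he, ?_⟩
  · rw [hqper (σ'.b1 + k) (by omega) (by omega), Nat.add_right_comm]
  · simp only [WordRepeat.p] at *
    omega
end

section
/- A maximal repeat in a word w is principal if and only if it is not covered by any other maximal repeat of w. -/
variable {A : Type*}

/-- The difference of the starting positions of a repeat shifts its whole factor. -/
theorem WordRepeat.eq_add_p {n : ℕ} {w : ℕ → A} (σ : WordRepeat n w) {k : ℕ}
    (hk : σ.b1 ≤ k) (hk' : k + σ.p ≤ σ.e2) : w k = w (k + σ.p) := by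
  have h1 := σ.b1_lt_b2
  have h2 := σ.len_eq
  have h3 := σ.b2_le_e2
  unfold WordRepeat.p at hk' ⊢
  have h := σ.copies_eq (k - σ.b1) (by omega)
  rwa [show σ.b1 + (k - σ.b1) = k by omega,
    show σ.b2 + (k - σ.b1) = k + (σ.b2 - σ.b1) by omega] at h

/-- The minimal period is at most every period. -/
theorem minPer_le {w : ℕ → A} {i j p : ℕ} (h : IsPeriodOf w i j p) : minPer w i j ≤ p :=
  Nat.sInf_le h

/-- The minimal period of a factor having some period is a period. -/
theorem isPeriodOf_minPer {w : ℕ → A} {i j p : ℕ} (h : IsPeriodOf w i j p) :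
    IsPeriodOf w i j (minPer w i j) :=
  Nat.sInf_mem (s := {p | IsPeriodOf w i j p}) ⟨p, h⟩

/-- A factor with period `m` extends to a factor which is maximal with that period. -/
theorem exists_maximal_extension (n : ℕ) (w : ℕ → A) (m i j : ℕ) (hi : 1 ≤ i)
    (hij : i + m ≤ j) (hj : j ≤ n) (h : ∀ k, i ≤ k → k + m ≤ j → w k = w (k + m)) :
    ∃ i' j', 1 ≤ i' ∧ i' ≤ i ∧ j ≤ j' ∧ j' ≤ n ∧
      (∀ k, i' ≤ k → k + m ≤ j' → w k = w (k + m)) ∧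
      (1 < i' → w (i' - 1) ≠ w (i' + m - 1)) ∧
      (j' < n → w (j' - m + 1) ≠ w (j' + 1)) := by
  induction hd : i + (n - j) using Nat.strong_induction_on generalizing i j with
  | _ d ih =>
    by_cases hl : 1 < i ∧ w (i - 1) = w (i + m - 1)
    · obtain ⟨i', j', h1, h2, h3⟩ := ih (i - 1 + (n - j)) (by omega) (i - 1) j (by omega)
        (by omega) hj (fun k hk hk' => by
          obtain rfl | hk := hk.eq_or_lt
          · rw [hl.2]; congr 1; omega
          · exact h k (by omega) hk') rfl
      exact ⟨i', j', h1, by omega, h3⟩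
    by_cases hr : j < n ∧ w (j - m + 1) = w (j + 1)
    · obtain ⟨i', j', h1, h2, h3, h4⟩ := ih (i + (n - (j + 1))) (by omega) i (j + 1) hi
        (by omega) (by omega) (fun k hk hk' => by
          obtain hk' | hk' := hk'.eq_or_lt
          · rw [hk', ← hr.2]; congr 1; omega
          · exact h k hk (by omega)) rfl
      exact ⟨i', j', h1, h2, by omega, h4⟩
    exact ⟨i, j, hi, le_rfl, le_rfl, hj, h, fun a b => hl ⟨a, b⟩, fun a b => hr ⟨a, b⟩⟩

/-- If the factor of a repeat has a period smaller than the period of the repeat, then the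
repeat is covered by a maximal repeat. -/
theorem WordRepeat.exists_maximal_coveredBy {n : ℕ} {w : ℕ → A} (σ : WordRepeat n w) {m : ℕ}
    (hm : IsPeriodOf w σ.b1 σ.e2 m) (hlt : m < σ.p) :
    ∃ σ' : WordRepeat n w, σ'.Maximal ∧ σ.CoveredBy σ' := by
  have hb := σ.b1_lt_b2
  have he := σ.b2_le_e2
  have hp : σ.p = σ.b2 - σ.b1 := rfl
  obtain ⟨hm0, -, hm⟩ := hm
  obtain ⟨i, j, h1, h2, h3, h4, h5, h6, h7⟩ :=
    exists_maximal_extension n w m σ.b1 σ.e2 σ.one_le_b1 (by omega) σ.e2_le_n hm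
  refine ⟨⟨i, j - m, i + m, j, h1, by omega, by omega, h4, by omega, by omega, fun k hk => ?_⟩,
    ⟨h6, h7⟩, h2, h3, ?_⟩
  · rw [h5 (i + k) (by omega) (by omega)]
    congr 1
    omega
  · simp only [WordRepeat.p] at hlt ⊢
    omega

/-- A maximal repeat is principal if and only if it is not covered by any other
maximal repeat. -/
theorem principal_iff_not_covered {A : Type*} (n : ℕ) (w : ℕ → A)
    (σ : WordRepeat n w) (hσ : σ.Maximal) :
    IsPrincipal σ ↔
      ∀ σ' : WordRepeat n w, σ'.Maximal → σ' ≠ σ → ¬ σ.CoveredBy σ' := by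
  have hb := σ.b1_lt_b2
  have he := σ.b2_le_e2
  have he' := σ.b1_le_e1
  have hl := σ.len_eq
  have hp : σ.p = σ.b2 - σ.b1 := rfl
  constructor
  · rintro ⟨i, j, -, rfl, -, h, rfl⟩ σ' - - ⟨h1, h2, h3⟩
    have hb' := σ'.b1_lt_b2
    have hp' : σ'.p = σ'.b2 - σ'.b1 := rfl
    have := minPer_le (w := w) (i := σ.b1) (j := σ.e2) (p := σ'.p)
      ⟨by omega, by omega, fun k hk hk' => σ'.eq_add_p (by omega) (by omega)⟩
    omega
  · intro h
    have hper : IsPeriodOf w σ.b1 σ.e2 σ.p :=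
      ⟨by omega, by omega, fun k hk hk' => σ.eq_add_p hk hk'⟩
    have hmin : minPer w σ.b1 σ.e2 = σ.p := by
      refine (minPer_le hper).antisymm (not_lt.mp fun hlt => ?_)
      obtain ⟨σ', hσ', hc⟩ := σ.exists_maximal_coveredBy (isPeriodOf_minPer hper) hlt
      exact h σ' hσ' (fun heq => (heq ▸ hc.2.2).false) hc
    have hmax : MaxCond n w σ.b1 σ.e2 := by
      rw [MaxCond, hmin, show σ.b1 + σ.p - 1 = σ.b2 - 1 by omega,
        show σ.e2 - σ.p + 1 = σ.e1 + 1 by omega]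
      exact ⟨hσ.1, fun hn => (hσ.2 hn).symm⟩
    have hn := σ.e2_le_n
    have h1 := σ.one_le_b1
    refine ⟨σ.b1, σ.e2, ?_, rfl, by omega, by omega, rfl⟩
    obtain hle | hlt := le_or_gt (2 * minPer w σ.b1 σ.e2) (σ.e2 - σ.b1 + 1)
    · exact Or.inl ⟨h1, by omega, hn, hle, hmax⟩
    · exact Or.inr ⟨h1, by omega, hn, by omega, hlt, hmax⟩
end
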